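/- arXiv:2305.06732 — 4 statements merged into one kernel-verified Lean document; each statement's English description precedes it below -/
import Mathlib

section
/- Let b = (b_1, …, b_d) ∈ ℤ^d be an integer point such that b − d^2·𝟙 ∈ Z^d and b_i ≤ 2^{d-2} for every 1 ≤ i ≤ d. Then b ∈ S. -/
open Finset

/-- The 0/1 vector in `ℝ^n` corresponding to a Boolean vector. -/
noncomputable def toVec {n : ℕ} (v : Fin n → Bool) : Fin n → ℝ :=
  fun i => if v i then 1 else 0

/-- The set `S` of degree sequences of hypergraphs on `n` vertices:
sums of sets of pairwise distinct 0/1 vectors. -/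
def degSeqs (n : ℕ) : Set (Fin n → ℝ) :=
  {b | ∃ U : Finset (Fin n → Bool), b = ∑ v ∈ U, toVec v}

/-- The degree-sequence polytope `Z^n`. -/
def dsPolytope (n : ℕ) : Set (Fin n → ℝ) :=
  {p | ∃ c : (Fin n → Bool) → ℝ, (∀ v, 0 ≤ c v ∧ c v ≤ 1) ∧
    p = ∑ v : Fin n → Bool, c v • toVec v}


/-- integer degree -/
def D {n : ℕ} (U : Finset (Fin n → Bool)) (i : Fin n) : ℤ :=
  ∑ v ∈ U, if v i then 1 else 0

def fl {n : ℕ} (i : Fin n) (v : Fin n → Bool) : Fin n → Bool := Function.update v i (!v i)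
def cp {n : ℕ} (v : Fin n → Bool) : Fin n → Bool := fun j => !v j

lemma fl_same {n : ℕ} (i : Fin n) (v : Fin n → Bool) : fl i v i = !v i := by simp [fl]
lemma fl_ne {n : ℕ} {i j : Fin n} (h : j ≠ i) (v : Fin n → Bool) : fl i v j = v j := by
  simp [fl, h]
lemma cp_apply {n : ℕ} (j : Fin n) (v : Fin n → Bool) : cp v j = !v j := rfl
lemma fl_fl {n : ℕ} (i : Fin n) (v : Fin n → Bool) : fl i (fl i v) = v := by
  ext j; by_cases h : j = i
  · subst h; simp [fl_same]
  · simp [fl_ne h]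
lemma cp_cp {n : ℕ} (v : Fin n → Bool) : cp (cp v) = v := by
  ext j; simp [cp_apply]
lemma cp_fl {n : ℕ} (i : Fin n) (v : Fin n → Bool) : cp (fl i v) = fl i (cp v) := by
  ext j; by_cases h : j = i
  · subst h; simp [fl_same, cp_apply]
  · simp [fl_ne h, cp_apply]

lemma D_eq_card {n : ℕ} (U : Finset (Fin n → Bool)) (i : Fin n) :
    D U i = ((U.filter (fun v => v i = true)).card : ℤ) := by
  simp [D]

lemma D_insert {n : ℕ} {U : Finset (Fin n → Bool)} {v : Fin n → Bool} (h : v ∉ U) (i : Fin n) :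
    D (insert v U) i = D U i + if v i then 1 else 0 := by
  rw [D, Finset.sum_insert h, D, add_comm]

lemma D_erase {n : ℕ} {U : Finset (Fin n → Bool)} {v : Fin n → Bool} (h : v ∈ U) (i : Fin n) :
    D (U.erase v) i = D U i - if v i then 1 else 0 := by
  rw [D, D, ← Finset.add_sum_erase U _ h]; ring

lemma gadget {n : ℕ} (hn : 2 ≤ n) (U : Finset (Fin n → Bool)) (i : Fin n)
    (h : D U i < 2 ^ (n - 2)) :
    ∃ U', ∀ j, D U' j = D U j + 1 + if j = i then 1 else 0 := by
  have key : ∃ x : Fin n → Bool, x i = true ∧ x ∉ U ∧ fl i (cp x) ∉ U := by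
    by_contra hcon
    push Not at hcon
    set A := U.filter (fun v => v i = true) with hA
    have hsub : (Finset.univ : Finset (Fin n → Bool)) ⊆
        (A ∪ A.image (fl i)) ∪ (A.image cp ∪ A.image (fun v => fl i (cp v))) := by
      intro v _
      simp only [Finset.mem_union, Finset.mem_image]
      by_cases hv : v i = true
      · by_cases hU : v ∈ U
        · left; left; simp [hA, hU, hv]
        · right; right
          refine ⟨fl i (cp v), ?_, ?_⟩
          · simp [hA, hcon v hv hU, fl_same, cp_apply, hv]
          · rw [cp_fl, cp_cp, fl_fl]
      · have hv' : v i = false := by simpa using hv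
        have hf : fl i v i = true := by simp [fl_same, hv']
        by_cases hU : fl i v ∈ U
        · left; right
          exact ⟨fl i v, by simp [hA, hU, hf], fl_fl i v⟩
        · right; left
          have := hcon _ hf hU
          rw [cp_fl, fl_fl] at this
          exact ⟨cp v, by simp [hA, this, cp_apply, hv'], cp_cp v⟩
    have h1 := Finset.card_le_card hsub
    have h2 := Finset.card_union_le (A ∪ A.image (fl i)) (A.image cp ∪ A.image (fun v => fl i (cp v)))
    have h3 := Finset.card_union_le A (A.image (fl i))
    have h4 := Finset.card_union_le (A.image cp) (A.image (fun v => fl i (cp v)))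
    have h5 := Finset.card_image_le (s := A) (f := fl i)
    have h6 := Finset.card_image_le (s := A) (f := cp)
    have h7 := Finset.card_image_le (s := A) (f := fun v => fl i (cp v))
    have h8 : (Finset.univ : Finset (Fin n → Bool)).card = 2 ^ (n - 2) * 4 := by
      have : n = (n - 2) + 2 := by omega
      rw [Finset.card_univ, Fintype.card_fun, Fintype.card_bool, Fintype.card_fin]
      conv_lhs => rw [this, pow_add]
      norm_num
    rw [D_eq_card] at h
    have h9 : A.card < 2 ^ (n - 2) := by exact_mod_cast h
    omega
  obtain ⟨x, hx, hxU, hyU⟩ := key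
  have hne : fl i (cp x) ≠ x := by
    intro he
    have : Nontrivial (Fin n) := Fin.nontrivial_iff_two_le.mpr hn
    obtain ⟨j, hj⟩ := exists_ne i
    have := congrFun he j
    rw [fl_ne hj, cp_apply] at this
    simp at this
  refine ⟨insert x (insert (fl i (cp x)) U), fun j => ?_⟩
  rw [D_insert, D_insert hyU]
  · by_cases hj : j = i
    · subst hj; simp [fl_same, cp_apply, hx]
    · rw [fl_ne hj, cp_apply]
      cases x j <;> simp [hj]
  · simp [hxU, hne.symm]

lemma plus {n : ℕ} (U : Finset (Fin n → Bool)) (i : Fin n)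
    (h : 2 * D U i < U.card) :
    ∃ U', U'.card = U.card ∧ ∀ j, D U' j = D U j + if j = i then 1 else 0 := by
  have key : ∃ v ∈ U, v i = false ∧ fl i v ∉ U := by
    by_contra hcon
    push Not at hcon
    set A := U.filter (fun v => v i = true) with hA
    have hsub : U ⊆ A ∪ A.image (fl i) := by
      intro v hv
      simp only [Finset.mem_union, Finset.mem_image]
      by_cases h1 : v i = true
      · left; simp [hA, hv, h1]
      · have hv' : v i = false := by simpa using h1
        right
        exact ⟨fl i v, by simp [hA, hcon v hv hv', fl_same, hv'], fl_fl i v⟩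
    have h1 := Finset.card_le_card hsub
    have h3 := Finset.card_union_le A (A.image (fl i))
    have h5 := Finset.card_image_le (s := A) (f := fl i)
    rw [D_eq_card] at h
    have h9 : 2 * A.card < U.card := by exact_mod_cast h
    omega
  obtain ⟨v, hv, hvi, hf⟩ := key
  have hf' : fl i v ∉ U.erase v := fun h => hf (Finset.mem_of_mem_erase h)
  refine ⟨insert (fl i v) (U.erase v), ?_, fun j => ?_⟩
  · rw [Finset.card_insert_of_notMem hf', Finset.card_erase_add_one hv]
  · rw [D_insert hf', D_erase hv]
    by_cases hj : j = i
    · subst hj; simp [fl_same, hvi]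
    · rw [fl_ne hj]; simp [hj]

lemma dec_sum {n : ℕ} {k : ℕ} {t : Fin n → ℕ} (h : ∑ i, t i = k + 1) :
    ∃ (i : Fin n) (t' : Fin n → ℕ), ∑ j, t' j = k ∧ ∀ j, t j = t' j + if j = i then 1 else 0 := by
  have : ∃ i, t i ≠ 0 := by
    by_contra hc
    push Not at hc
    simp [hc] at h
  obtain ⟨i, hi⟩ := this
  have ht : ∀ j, t j = (t j - if j = i then 1 else 0) + if j = i then 1 else 0 := by
    intro j
    by_cases hj : j = i
    · subst hj; simp; omega
    · simp [hj]
  refine ⟨i, fun j => t j - if j = i then 1 else 0, ?_, ht⟩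
  have h2 : ∑ j, t j = ∑ j, (t j - if j = i then 1 else 0) + 1 := by
    conv_lhs => rw [Finset.sum_congr rfl (fun j _ => ht j)]
    rw [Finset.sum_add_distrib]; simp
  show ∑ j, (t j - if j = i then 1 else 0) = k
  omega

lemma phase3 {n : ℕ} (hn : 2 ≤ n) (b : Fin n → ℤ) (hub : ∀ i, b i ≤ 2 ^ (n - 2)) (k : ℕ) :
    ∀ (U : Finset (Fin n → Bool)) (t : Fin n → ℕ), ∑ i, t i = k → 2 ^ (n - 1) ≤ U.card →
      (∀ i, b i = D U i + t i) → ∃ U', ∀ i, b i = D U' i := by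
  induction k with
  | zero =>
    intro U t ht _ hb
    refine ⟨U, fun i => ?_⟩
    have : t i = 0 := by
      simpa using (Finset.sum_eq_zero_iff.mp ht) i (Finset.mem_univ i)
    simp [hb i, this]
  | succ k ih =>
    intro U t ht hU hb
    obtain ⟨i, t', ht', htt⟩ := dec_sum ht
    have hlt : 2 * D U i < U.card := by
      have h1 := hb i
      have h2 := htt i
      have h3 := hub i
      have h4 : (2 : ℤ) ^ (n - 1) = 2 * 2 ^ (n - 2) := by
        have : n - 1 = (n - 2) + 1 := by omega
        rw [this, pow_succ]; ring
      have h5 : (2 : ℤ) ^ (n - 1) ≤ U.card := by exact_mod_cast hU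
      simp at h2
      have : (t i : ℤ) = t' i + 1 := by exact_mod_cast h2
      have : (0 : ℤ) ≤ t' i := by positivity
      linarith
    obtain ⟨U', hc, hD⟩ := plus U i hlt
    refine ih U' t' ht' (by rw [hc]; exact hU) (fun j => ?_)
    rw [hb j, hD j, htt j]
    push_cast; ring

lemma phase2 {n : ℕ} (hn : 2 ≤ n) (b : Fin n → ℤ) (hub : ∀ i, b i ≤ 2 ^ (n - 2)) (m : ℕ) :
    ∀ (U : Finset (Fin n → Bool)), (∀ i, b i = D U i + m) → ∃ U', ∀ i, b i = D U' i := by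
  induction m with
  | zero => intro U hb; exact ⟨U, fun i => by simp [hb i]⟩
  | succ m ih =>
    intro U hb
    by_cases hw : ∃ w, w ∉ U ∧ cp w ∉ U
    · obtain ⟨w, h1, h2⟩ := hw
      have hne : w ≠ cp w := by
        intro he
        have := congrFun he (⟨0, by omega⟩ : Fin n)
        rw [cp_apply] at this
        simp at this
      refine ih (insert w (insert (cp w) U)) (fun j => ?_)
      rw [D_insert (by simp [h1, hne]), D_insert h2, hb j, cp_apply]
      cases w j <;> simp <;> ring
    · push Not at hw
      refine phase3 hn b hub _ U (fun _ => m + 1) rfl ?_ (fun i => by simpa using hb i)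
      have hsub : (Finset.univ : Finset (Fin n → Bool)) ⊆ U ∪ U.image cp := by
        intro v _
        simp only [Finset.mem_union, Finset.mem_image]
        by_cases hU : v ∈ U
        · left; exact hU
        · right; exact ⟨cp v, hw v hU, cp_cp v⟩
      have h1 := Finset.card_le_card hsub
      have h3 := Finset.card_union_le U (U.image cp)
      have h5 := Finset.card_image_le (s := U) (f := cp)
      have h8 : (Finset.univ : Finset (Fin n → Bool)).card = 2 ^ (n - 1) * 2 := by
        have : n = (n - 1) + 1 := by omega
        rw [Finset.card_univ, Fintype.card_fun, Fintype.card_bool, Fintype.card_fin]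
        conv_lhs => rw [this, pow_succ]
      omega

lemma phase1 {n : ℕ} (hn : 2 ≤ n) (b : Fin n → ℤ) (hub : ∀ i, b i ≤ 2 ^ (n - 2)) (k : ℕ) :
    ∀ (U : Finset (Fin n → Bool)) (t : Fin n → ℕ) (m : ℕ), ∑ i, t i = k → k ≤ m →
      (∀ i, b i = D U i + m + t i) → ∃ U', ∀ i, b i = D U' i := by
  induction k with
  | zero =>
    intro U t m ht _ hb
    refine phase2 hn b hub m U (fun i => ?_)
    have : t i = 0 := by
      simpa using (Finset.sum_eq_zero_iff.mp ht) i (Finset.mem_univ i)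
    simp [hb i, this]
  | succ k ih =>
    intro U t m ht hm hb
    obtain ⟨i, t', ht', htt⟩ := dec_sum ht
    obtain ⟨m, rfl⟩ : ∃ m', m = m' + 1 := ⟨m - 1, by omega⟩
    have hlt : D U i < 2 ^ (n - 2) := by
      have h1 := hb i
      have h3 := hub i
      push_cast at h1
      have : (0 : ℤ) ≤ t i := by positivity
      have : (0 : ℤ) ≤ m := by positivity
      linarith
    obtain ⟨U', hD⟩ := gadget hn U i hlt
    refine ih U' t' m ht' (by omega) (fun j => ?_)
    rw [hb j, hD j, htt j]
    push_cast; ring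

/-- reduce number of fractional coordinates -/
lemma few_frac {ι : Type*} [Fintype ι] {n : ℕ} (f : ι → Fin n → ℝ) (p : Fin n → ℝ) (k : ℕ) :
    ∀ c : ι → ℝ, (∀ v, 0 ≤ c v ∧ c v ≤ 1) → p = ∑ v, c v • f v →
      (Finset.univ.filter (fun v => 0 < c v ∧ c v < 1)).card = k →
    ∃ c : ι → ℝ, (∀ v, 0 ≤ c v ∧ c v ≤ 1) ∧ p = ∑ v, c v • f v ∧
      (Finset.univ.filter (fun v => 0 < c v ∧ c v < 1)).card ≤ n := by
  classical
  induction k using Nat.strong_induction_on with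
  | _ k ih =>
    intro c hc hp hk
    by_cases hkn : k ≤ n
    · exact ⟨c, hc, hp, hk ▸ hkn⟩
    push Not at hkn
    set F := Finset.univ.filter (fun v => 0 < c v ∧ c v < 1) with hF
    have hdep : ¬ LinearIndependent ℝ (fun v : F => f v) := by
      intro hli
      have := hli.fintype_card_le_finrank
      simp at this
      omega
    obtain ⟨g0, hg0, i0, hi0⟩ := Fintype.not_linearIndependent_iff.mp hdep
    set g : ι → ℝ := fun v => if h : v ∈ F then g0 ⟨v, h⟩ else 0 with hg
    have hgout : ∀ v, v ∉ F → g v = 0 := fun v h => by simp [hg, h]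
    have hgsum : ∑ v, g v • f v = 0 := by
      rw [← Finset.sum_subset (Finset.subset_univ F) (fun v _ h => by simp [hgout v h]),
        ← Finset.sum_coe_sort F (fun v => g v • f v), ← hg0]
      refine Finset.sum_congr rfl (fun v _ => ?_)
      simp [hg]
    set G := F.filter (fun v => g v ≠ 0) with hG
    have hGne : G.Nonempty := ⟨i0, by simp [hG, hg, hi0]⟩
    set τ : ι → ℝ := fun v => if 0 < g v then (1 - c v) / g v else c v / (- g v) with hτ
    obtain ⟨v0, hv0, hmin⟩ := Finset.exists_min_image G τ hGne
    have hFmem : ∀ v, v ∈ F ↔ 0 < c v ∧ c v < 1 := fun v => by simp [hF]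
    have hτpos : ∀ v ∈ G, 0 < τ v := by
      intro v hv
      have hvF := (hFmem v).mp (Finset.mem_filter.mp hv).1
      have hne := (Finset.mem_filter.mp hv).2
      simp only [hτ]
      split_ifs with h
      · exact div_pos (by linarith) h
      · have : g v < 0 := lt_of_le_of_ne (not_lt.mp h) hne
        exact div_pos hvF.1 (by linarith)
    have ht0 := hτpos v0 hv0
    set T := τ v0 with hT
    have hbd : ∀ v, 0 ≤ c v + T * g v ∧ c v + T * g v ≤ 1 := by
      intro v
      by_cases hv : v ∈ G
      · have hle := hmin v hv
        have hne := (Finset.mem_filter.mp hv).2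
        have hcv := hc v
        simp only [hτ] at hle
        split_ifs at hle with h
        · rw [le_div_iff₀ h] at hle
          have := mul_pos ht0 h
          constructor <;> linarith
        · have h' : g v < 0 := lt_of_le_of_ne (not_lt.mp h) hne
          rw [le_div_iff₀ (by linarith)] at hle
          have := mul_pos_of_neg_of_neg h' (neg_neg_of_pos ht0)
          constructor <;> nlinarith
      · have : g v = 0 := by
          by_cases hvF : v ∈ F
          · by_contra hne; exact hv (Finset.mem_filter.mpr ⟨hvF, hne⟩)
          · exact hgout v hvF
        simpa [this] using hc v
    have hend : c v0 + T * g v0 = 0 ∨ c v0 + T * g v0 = 1 := by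
      have hne := (Finset.mem_filter.mp hv0).2
      simp only [hT, hτ]
      split_ifs with h
      · right; field_simp; ring
      · left; field_simp; ring
    refine ih _ ?_ (fun v => c v + T * g v) hbd ?_ rfl
    · rw [← hk]
      apply Finset.card_lt_card
      refine ⟨?_, ?_⟩
      · intro v hv
        by_contra hvF
        have h1 : 0 < c v + T * g v ∧ c v + T * g v < 1 := by simpa using hv
        rw [hgout v hvF] at h1
        exact hvF ((hFmem v).mpr (by simpa using h1))
      · intro hsub
        have := hsub (Finset.mem_filter.mp hv0).1
        have h1 : 0 < c v0 + T * g v0 ∧ c v0 + T * g v0 < 1 := by simpa using this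
        rcases hend with h | h <;> linarith [h1.1, h1.2]
    · simp only [add_smul, mul_smul, Finset.sum_add_distrib, ← Finset.smul_sum, hgsum]
      simpa using hp

lemma D_cast {n : ℕ} (U : Finset (Fin n → Bool)) (i : Fin n) :
    ((D U i : ℤ) : ℝ) = ∑ v ∈ U, toVec v i := by
  simp only [D, toVec]; push_cast; rfl

lemma start {d : ℕ} (b : Fin d → ℤ)
    (hZ : (fun i => (b i : ℝ) - (d : ℝ) ^ 2) ∈ dsPolytope d) :
    ∃ (U : Finset (Fin d → Bool)) (t : Fin d → ℕ), (∀ i, t i ≤ d) ∧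
      ∀ i, b i = D U i + (d ^ 2 : ℕ) + t i := by
  classical
  obtain ⟨c, hc, hp⟩ := hZ
  obtain ⟨c, hc, hp, hcard⟩ := few_frac toVec _ _ c hc hp rfl
  set F := Finset.univ.filter (fun v => 0 < c v ∧ c v < 1) with hF
  set U := Finset.univ.filter (fun v => c v = 1) with hU
  have hi : ∀ i, (b i : ℝ) - d ^ 2 = D U i + ∑ v ∈ F, c v * toVec v i := by
    intro i
    have := congrFun hp i
    simp only [Finset.sum_apply, Pi.smul_apply, smul_eq_mul] at this
    rw [this, D_cast, hU, hF, Finset.sum_filter, Finset.sum_filter, ← Finset.sum_add_distrib]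
    refine Finset.sum_congr rfl (fun v _ => ?_)
    have hv := hc v
    by_cases h1 : c v = 1
    · simp [h1]
    · have h1' : c v < 1 := lt_of_le_of_ne hv.2 h1
      by_cases h0 : c v = 0
      · simp [h0]
      · have : 0 < c v := lt_of_le_of_ne hv.1 (Ne.symm h0)
        simp [h1, h1', this]
  have htv : ∀ (v : Fin d → Bool) i, 0 ≤ toVec v i ∧ toVec v i ≤ 1 := by
    intro v i
    simp only [toVec]; split_ifs <;> simp
  have hlo : ∀ i, 0 ≤ ∑ v ∈ F, c v * toVec v i := fun i =>
    Finset.sum_nonneg (fun v _ => mul_nonneg (hc v).1 (htv v i).1)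
  have hhi : ∀ i, ∑ v ∈ F, c v * toVec v i ≤ d := fun i => by
    calc ∑ v ∈ F, c v * toVec v i ≤ ∑ v ∈ F, (1 : ℝ) :=
          Finset.sum_le_sum (fun v _ => mul_le_one₀ (hc v).2 (htv v i).1 (htv v i).2)
      _ = F.card := by simp
      _ ≤ d := by exact_mod_cast hcard
  have hz0 : ∀ i, 0 ≤ b i - d ^ 2 - D U i := fun i => by
    have : (0 : ℝ) ≤ ((b i - d ^ 2 - D U i : ℤ) : ℝ) := by
      push_cast; linarith [hi i, hlo i]
    exact_mod_cast this
  have hz1 : ∀ i, b i - d ^ 2 - D U i ≤ d := fun i => by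
    have : ((b i - d ^ 2 - D U i : ℤ) : ℝ) ≤ ((d : ℤ) : ℝ) := by
      push_cast; linarith [hi i, hhi i]
    exact_mod_cast this
  refine ⟨U, fun i => (b i - d ^ 2 - D U i).toNat, fun i => ?_, fun i => ?_⟩
  · have := hz1 i
    simpa using hz1 i
  · rw [Int.toNat_of_nonneg (hz0 i)]; push_cast; ring

/-- If `b - d² 𝟙 ∈ Z^d` and `bᵢ ≤ 2^(d-2)` for all `i`, then `b` is a degree sequence. -/
theorem theorem_F (d : ℕ) (b : Fin d → ℤ)
    (hZ : (fun i => (b i : ℝ) - (d : ℝ) ^ 2) ∈ dsPolytope d)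
    (hub : ∀ i, b i ≤ 2 ^ (d - 2)) :
    (fun i => (b i : ℝ)) ∈ degSeqs d := by
  suffices h : ∃ U, ∀ i, b i = D U i by
    obtain ⟨U, hU⟩ := h
    refine ⟨U, ?_⟩
    funext i
    rw [hU i, D_cast, Finset.sum_apply]
  obtain ⟨U, t, ht, hb⟩ := start b hZ
  rcases Nat.lt_or_ge d 2 with hd | hd
  · interval_cases d
    · exact ⟨∅, fun i => i.elim0⟩
    · refine ⟨{fun _ => true}, fun i => ?_⟩
      have h1 := hub i
      have h2 := hb i
      have h3 : 0 ≤ D U i := by rw [D_eq_card]; positivity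
      have h4 : D {fun _ : Fin 1 => true} i = 1 := by rw [D, Finset.sum_singleton]; simp
      rw [h4]
      norm_num at h1 h2
      omega
  · refine phase1 hd b hub _ U t (d ^ 2) rfl ?_ hb
    calc ∑ i, t i ≤ ∑ _i : Fin d, d := Finset.sum_le_sum (fun i _ => ht i)
      _ = d ^ 2 := by simp [sq]
end

section
/- Let b = (b_1, …, b_d) ∈ ℤ^d be an integer point such that b + d^2·𝟙 ∈ Z^d and b_i ≥ 2^{d-2} for every 1 ≤ i ≤ d. Then b ∈ S. -/
open Finset

/-- integer degree -/
def dg {d : ℕ} (U : Finset (Fin d → Bool)) (i : Fin d) : ℤ :=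
  ∑ v ∈ U, if v i = true then 1 else 0

theorem dg_card {d : ℕ} (U : Finset (Fin d → Bool)) (i : Fin d) :
    dg U i = ((U.filter (fun v => v i = true)).card : ℤ) := by
  unfold dg
  simp

theorem dg_erase {d : ℕ} (U : Finset (Fin d → Bool)) (i : Fin d) (v : Fin d → Bool)
    (hv : v ∈ U) : dg (U.erase v) i = dg U i - if v i = true then 1 else 0 := by
  unfold dg
  rw [← Finset.add_sum_erase U _ hv]
  ring

theorem dg_insert {d : ℕ} (U : Finset (Fin d → Bool)) (i : Fin d) (v : Fin d → Bool)
    (hv : v ∉ U) : dg (insert v U) i = dg U i + if v i = true then 1 else 0 := by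
  unfold dg
  rw [Finset.sum_insert hv]
  ring

theorem pow_facts {d : ℕ} (hd : 2 ≤ d) :
    2 ^ d = 4 * 2 ^ (d - 2) ∧ 2 ^ (d - 1) = 2 * 2 ^ (d - 2) := by
  obtain ⟨k, rfl⟩ := Nat.exists_eq_add_of_le hd
  have h1 : 2 + k - 2 = k := by omega
  have h2 : 2 + k - 1 = k + 1 := by omega
  rw [h1, h2]
  constructor <;> ring

theorem upd_inj {d : ℕ} (i : Fin d) (x : Bool) (v w : Fin d → Bool) (h : v i = w i)
    (e : Function.update v i x = Function.update w i x) : v = w := by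
  funext j
  by_cases hj : j = i
  · subst hj; exact h
  · have := congrFun e j
    simpa [Function.update_of_ne hj] using this

theorem exists_swapdown {d : ℕ} (hd : 2 ≤ d) (U : Finset (Fin d → Bool)) (i : Fin d)
    (hc : U.card ≤ 2 ^ (d - 1)) (hi : (2 : ℤ) ^ (d - 2) < dg U i) :
    ∃ v ∈ U, v i = true ∧ Function.update v i false ∉ U := by
  by_contra! hcon
  have h1 : (U.filter (fun v => v i = true)).card ≤ (U.filter (fun v => ¬ v i = true)).card := by
    apply Finset.card_le_card_of_injOn (fun v => Function.update v i false)
    · intro v hv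
      have hv' : v ∈ U ∧ v i = true := by simpa using hv
      have := hcon v hv'.1 hv'.2
      simp [this]
    · intro v hv w hw e
      have hv' : v ∈ U ∧ v i = true := by simpa using hv
      have hw' : w ∈ U ∧ w i = true := by simpa using hw
      exact upd_inj i false v w (by rw [hv'.2, hw'.2]) e
  have h2 := Finset.card_filter_add_card_filter_not (s := U) (fun v => v i = true)
  rw [dg_card] at hi
  have hi' : 2 ^ (d - 2) < (U.filter (fun v => v i = true)).card := by exact_mod_cast hi
  have := (pow_facts hd).2
  omega

theorem small_case {d : ℕ} (hd : 2 ≤ d) (b : Fin d → ℤ) (hlb : ∀ i, 2 ^ (d - 2) ≤ b i) :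
    ∀ (n : ℕ) (U : Finset (Fin d → Bool)), U.card ≤ 2 ^ (d - 1) → (∀ i, b i ≤ dg U i) →
      ∑ i, (dg U i - b i) = n → ∃ U' : Finset (Fin d → Bool), ∀ i, dg U' i = b i := by
  intro n
  induction n with
  | zero =>
    intro U _ hb hs
    refine ⟨U, fun i => ?_⟩
    have := (Finset.sum_eq_zero_iff_of_nonneg (fun i _ => sub_nonneg.2 (hb i))).1
      (by simpa using hs) i (Finset.mem_univ i)
    linarith
  | succ n ih =>
    intro U hc hb hs
    obtain ⟨i, hi⟩ : ∃ i, b i < dg U i := by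
      by_contra! hcon
      have : ∑ i, (dg U i - b i) ≤ 0 := Finset.sum_nonpos (fun i _ => by linarith [hcon i])
      push_cast at hs
      linarith [Int.natCast_nonneg n]
    obtain ⟨v, hv, hvi, hn⟩ := exists_swapdown hd U i hc (lt_of_le_of_lt (hlb i) hi)
    have hn' : Function.update v i false ∉ U.erase v := fun h => hn (Finset.mem_of_mem_erase h)
    have key : ∀ j, dg (insert (Function.update v i false) (U.erase v)) j
        = dg U j - if j = i then 1 else 0 := by
      intro j
      rw [dg_insert _ _ _ hn', dg_erase _ _ _ hv]
      by_cases hj : j = i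
      · subst hj; simp [hvi]
      · simp [hj]
    apply ih (insert (Function.update v i false) (U.erase v))
    · rw [Finset.card_insert_of_notMem hn', Finset.card_erase_of_mem hv]
      have : 0 < U.card := Finset.card_pos.2 ⟨v, hv⟩
      omega
    · intro j
      rw [key]
      by_cases hj : j = i
      · subst hj; simp; omega
      · simp [hj, hb j]
    · simp only [key]
      have : ∑ j, (dg U j - (if j = i then 1 else 0) - b j)
          = ∑ j, (dg U j - b j) - ∑ j, (if j = i then (1 : ℤ) else 0) := by
        rw [← Finset.sum_sub_distrib]
        exact Finset.sum_congr rfl (fun j _ => by ring)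
      rw [this, hs]
      simp

/-- complement -/
def cpl {d : ℕ} (v : Fin d → Bool) : Fin d → Bool := fun j => !(v j)

theorem cpl_inj {d : ℕ} : Function.Injective (cpl (d := d)) := by
  intro v w h
  funext j
  have := congrFun h j
  simpa [cpl] using this

theorem exists_compl {d : ℕ} (hd : 2 ≤ d) (U : Finset (Fin d → Bool))
    (hc : 2 ^ (d - 1) < U.card) : ∃ v ∈ U, cpl v ∈ U := by
  by_contra! hcon
  have hdis : Disjoint U (U.image cpl) := by
    rw [Finset.disjoint_right]
    intro w hw hw'
    obtain ⟨v, hv, rfl⟩ := Finset.mem_image.1 hw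
    exact hcon v hv hw'
  have h1 := Finset.card_le_univ (U ∪ U.image cpl)
  rw [Finset.card_union_of_disjoint hdis, Finset.card_image_of_injective _ cpl_inj] at h1
  have h2 : Fintype.card (Fin d → Bool) = 2 ^ d := by simp
  have := pow_facts hd
  omega

theorem exists_compl_i {d : ℕ} (hd : 2 ≤ d) (U : Finset (Fin d → Bool)) (i : Fin d)
    (hi : (2 : ℤ) ^ (d - 2) < dg U i) :
    ∃ v ∈ U, v i = true ∧ Function.update (cpl v) i true ∈ U := by
  by_contra! hcon
  rw [dg_card] at hi
  have hi' : 2 ^ (d - 2) < (U.filter (fun v => v i = true)).card := by exact_mod_cast hi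
  set F := U.filter (fun v => v i = true) with hF
  have hFm : ∀ v ∈ F, v ∈ U ∧ v i = true := fun v hv => by simpa [hF] using hv
  set G := F.image (fun v => Function.update (cpl v) i true) with hG
  have hGc : G.card = F.card := by
    apply Finset.card_image_of_injOn
    intro v hv w hw e
    have hv' := hFm v hv
    have hw' := hFm w hw
    exact cpl_inj (upd_inj i true _ _ (by simp [cpl, hv'.2, hw'.2]) e)
  have hdis : Disjoint F G := by
    rw [Finset.disjoint_right]
    intro w hw hw'
    obtain ⟨v, hv, rfl⟩ := Finset.mem_image.1 hw
    exact hcon v (hFm v hv).1 (hFm v hv).2 (hFm _ hw').1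
  have hall : ∀ v ∈ F ∪ G, v i = true := by
    intro v hv
    rcases Finset.mem_union.1 hv with h | h
    · exact (hFm v h).2
    · obtain ⟨w, _, rfl⟩ := Finset.mem_image.1 h
      simp
  have hdis2 : Disjoint (F ∪ G) ((F ∪ G).image cpl) := by
    rw [Finset.disjoint_right]
    intro w hw hw'
    obtain ⟨v, hv, rfl⟩ := Finset.mem_image.1 hw
    have h1 := hall v hv
    have h2 := hall _ hw'
    simp [cpl, h1] at h2
  have h1 := Finset.card_le_univ ((F ∪ G) ∪ (F ∪ G).image cpl)
  rw [Finset.card_union_of_disjoint hdis2, Finset.card_image_of_injective _ cpl_inj,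
    Finset.card_union_of_disjoint hdis, hGc] at h1
  have h2 : Fintype.card (Fin d → Bool) = 2 ^ d := by simp
  have := pow_facts hd
  omega

theorem main_descent {d : ℕ} (hd : 2 ≤ d) (b : Fin d → ℤ) (hlb : ∀ i, 2 ^ (d - 2) ≤ b i) :
    ∀ (m : ℕ) (U : Finset (Fin d → Bool)), (∀ i, (m : ℤ) ≤ dg U i - b i) →
      ∑ i, (dg U i - b i - m) ≤ m → ∃ U' : Finset (Fin d → Bool), ∀ i, dg U' i = b i := by
  intro m
  induction m with
  | zero =>
    intro U hm hs
    refine ⟨U, fun i => ?_⟩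
    have hnn : ∀ i ∈ Finset.univ, 0 ≤ dg U i - b i - ((0 : ℕ) : ℤ) :=
      fun i _ => by linarith [hm i]
    have := (Finset.sum_eq_zero_iff_of_nonneg hnn).1
      (le_antisymm (by simpa using hs) (Finset.sum_nonneg hnn)) i (Finset.mem_univ i)
    push_cast at this
    linarith
  | succ m ih =>
    intro U hm hs
    push_cast at hm hs
    by_cases hD : ∃ i, (m : ℤ) + 1 < dg U i - b i
    · obtain ⟨i, hi⟩ := hD
      obtain ⟨v, hv, hvi, hw⟩ := exists_compl_i hd U i (by
        have := hlb i
        linarith [Int.natCast_nonneg m])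
      set w := Function.update (cpl v) i true with hwdef
      have hne : w ≠ v := by
        intro h
        have : ∃ j : Fin d, j ≠ i := by
          have : Nontrivial (Fin d) := Fin.nontrivial_iff_two_le.2 hd
          exact exists_ne i
        obtain ⟨j, hj⟩ := this
        have := congrFun h j
        simp [hwdef, hj, cpl] at this
      have hw' : w ∈ U.erase v := Finset.mem_erase.2 ⟨hne, hw⟩
      have key : ∀ j, dg ((U.erase v).erase w) j = dg U j - 1 - if j = i then 1 else 0 := by
        intro j
        rw [dg_erase _ _ _ hw', dg_erase _ _ _ hv]
        by_cases hj : j = i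
        · subst hj; simp [hvi, hwdef]
        · cases h : v j <;> simp [hj, hwdef, cpl, h]
      apply ih ((U.erase v).erase w)
      · intro j
        rw [key]
        by_cases hj : j = i
        · subst hj; simp; linarith
        · simp [hj]; linarith [hm j]
      · simp only [key]
        have : ∑ j, (dg U j - 1 - (if j = i then 1 else 0) - b j - m)
          = ∑ j, (dg U j - b j - (m + 1)) - ∑ j, (if j = i then (1 : ℤ) else 0) := by
          rw [← Finset.sum_sub_distrib]
          exact Finset.sum_congr rfl (fun j _ => by ring)
        rw [this]
        simp only [Finset.sum_ite_eq', Finset.mem_univ, if_true]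
        linarith
    · push Not at hD
      by_cases hc : U.card ≤ 2 ^ (d - 1)
      · have hb : ∀ i, b i ≤ dg U i := fun i => by linarith [hm i, Int.natCast_nonneg m]
        exact small_case hd b hlb (∑ i, (dg U i - b i)).toNat U hc hb
          (Int.toNat_of_nonneg (Finset.sum_nonneg fun i _ => sub_nonneg.2 (hb i))).symm
      · obtain ⟨v, hv, hw⟩ := exists_compl hd U (not_le.1 hc)
        have hne : cpl v ≠ v := by
          intro h
          have := congrFun h ⟨0, by omega⟩
          simp [cpl] at this
        have hw' : cpl v ∈ U.erase v := Finset.mem_erase.2 ⟨hne, hw⟩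
        have key : ∀ j, dg ((U.erase v).erase (cpl v)) j = dg U j - 1 := by
          intro j
          rw [dg_erase _ _ _ hw', dg_erase _ _ _ hv]
          cases h : v j <;> simp [cpl, h]
        apply ih ((U.erase v).erase (cpl v))
        · intro j
          rw [key]
          linarith [hm j]
        · have : ∑ j, (dg ((U.erase v).erase (cpl v)) j - b j - m) ≤ 0 :=
            Finset.sum_nonpos fun j _ => by rw [key]; linarith [hD j]
          linarith [Int.natCast_nonneg m]

theorem exists_vertex {d : ℕ} (p : Fin d → ℝ) (hp : p ∈ dsPolytope d) :
    ∃ c : (Fin d → Bool) → ℝ, (∀ v, 0 ≤ c v ∧ c v ≤ 1) ∧ p = ∑ v, c v • toVec v ∧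
      (Finset.univ.filter (fun v => 0 < c v ∧ c v < 1)).card ≤ d := by
  obtain ⟨c0, hc0, hp0⟩ := hp
  set K : Set ((Fin d → Bool) → ℝ) :=
    Set.Icc 0 1 ∩ {c | ∑ v, c v • toVec v = p} with hK
  have hKc : IsCompact K := by
    apply isCompact_Icc.inter_right
    apply isClosed_eq
    · fun_prop
    · exact continuous_const
  have hKn : K.Nonempty := ⟨c0, ⟨fun v => (hc0 v).1, fun v => (hc0 v).2⟩, hp0.symm⟩
  obtain ⟨c, hc⟩ := hKc.extremePoints_nonempty hKn
  have hcK : c ∈ K := hc.1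
  refine ⟨c, fun v => ⟨hcK.1.1 v, hcK.1.2 v⟩, hcK.2.symm, ?_⟩
  by_contra! hcard
  set F := Finset.univ.filter (fun v => 0 < c v ∧ c v < 1) with hF
  have hnl : ¬ LinearIndependent ℝ (fun v : F => toVec (v : Fin d → Bool)) := by
    intro hli
    have := hli.fintype_card_le_finrank
    simp at this
    omega
  rw [Fintype.not_linearIndependent_iff] at hnl
  obtain ⟨g0, hg0, ⟨i0, hi0⟩⟩ := hnl
  set g : (Fin d → Bool) → ℝ := fun v => if h : v ∈ F then g0 ⟨v, h⟩ else 0 with hg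
  have hgs : ∑ v, g v • toVec v = 0 := by
    rw [← Finset.sum_subset (Finset.subset_univ F)]
    · rw [← hg0, ← Finset.sum_coe_sort F]
      exact Finset.sum_congr rfl fun v _ => by simp [hg]
    · intro v _ hv
      simp [hg, hv]
  have hev : ∀ᶠ t : ℝ in nhds 0, ∀ v, 0 ≤ c v + t * g v ∧ c v + t * g v ≤ 1 ∧
      0 ≤ c v - t * g v ∧ c v - t * g v ≤ 1 := by
    rw [Filter.eventually_all]
    intro v
    by_cases hv : v ∈ F
    · have hv' : 0 < c v ∧ c v < 1 := by simpa [hF] using hv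
      have t1 : Filter.Tendsto (fun t : ℝ => c v + t * g v) (nhds 0) (nhds (c v)) := by
        have : Continuous (fun t : ℝ => c v + t * g v) := by fun_prop
        simpa using this.tendsto 0
      have t2 : Filter.Tendsto (fun t : ℝ => c v - t * g v) (nhds 0) (nhds (c v)) := by
        have : Continuous (fun t : ℝ => c v - t * g v) := by fun_prop
        simpa using this.tendsto 0
      filter_upwards [t1.eventually (lt_mem_nhds hv'.1), t1.eventually (gt_mem_nhds hv'.2),
        t2.eventually (lt_mem_nhds hv'.1), t2.eventually (gt_mem_nhds hv'.2)] with t a1 a2 a3 a4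
      exact ⟨a1.le, a2.le, a3.le, a4.le⟩
    · have hgv : g v = 0 := by simp [hg, hv]
      have h0 : 0 ≤ c v := hcK.1.1 v
      have h1 : c v ≤ 1 := hcK.1.2 v
      simp [hgv, h0, h1]
  obtain ⟨t, ht, ht0⟩ := ((hev.filter_mono nhdsWithin_le_nhds).and
    (self_mem_nhdsWithin (a := (0 : ℝ)) (s := {0}ᶜ))).exists
  have ht0' : t ≠ 0 := by simpa using ht0
  have hA : (fun v => c v + t * g v) ∈ K := by
    refine ⟨⟨fun v => (ht v).1, fun v => (ht v).2.1⟩, ?_⟩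
    have h := hcK.2
    simp only [Set.mem_setOf_eq] at h ⊢
    simp only [add_smul, mul_smul, Finset.sum_add_distrib, ← Finset.smul_sum, hgs, h]
    simp
  have hB : (fun v => c v - t * g v) ∈ K := by
    refine ⟨⟨fun v => (ht v).2.2.1, fun v => (ht v).2.2.2⟩, ?_⟩
    have h := hcK.2
    simp only [Set.mem_setOf_eq] at h ⊢
    simp only [sub_smul, mul_smul, Finset.sum_sub_distrib, ← Finset.smul_sum, hgs, h]
    simp
  have hseg : c ∈ openSegment ℝ (fun v => c v + t * g v) (fun v => c v - t * g v) := by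
    refine ⟨1 / 2, 1 / 2, by norm_num, by norm_num, by norm_num, ?_⟩
    funext v
    simp
    ring
  have heq := hc.2 hA hB hseg
  have h1 := congrFun heq i0
  have h2 : g i0 = g0 i0 := by simp [hg]
  simp only [h2] at h1
  have : t * g0 i0 = 0 := by linarith
  rcases mul_eq_zero.1 this with h | h
  · exact ht0' h
  · exact hi0 h

theorem dg_real {d : ℕ} (U : Finset (Fin d → Bool)) (i : Fin d) :
    (∑ v ∈ U, toVec v) i = (dg U i : ℝ) := by
  simp [dg, toVec, Finset.sum_apply]

/-- If `b + d² 𝟙 ∈ Z^d` and `bᵢ ≥ 2^(d-2)` for all `i`, then `b` is a degree sequence. -/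
theorem theorem_F2 (d : ℕ) (b : Fin d → ℤ)
    (hZ : (fun i => (b i : ℝ) + (d : ℝ) ^ 2) ∈ dsPolytope d)
    (hlb : ∀ i, 2 ^ (d - 2) ≤ b i) :
    (fun i => (b i : ℝ)) ∈ degSeqs d := by
  obtain ⟨c, hc, hp, hcard⟩ := exists_vertex _ hZ
  suffices h : ∃ U' : Finset (Fin d → Bool), ∀ i, dg U' i = b i by
    obtain ⟨U, hU⟩ := h
    refine ⟨U, ?_⟩
    funext i
    rw [dg_real, hU]
  rcases Nat.lt_or_ge d 2 with hd | hd
  · interval_cases d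
    · exact ⟨∅, fun i => i.elim0⟩
    · exfalso
      have h1 := congrFun hp 0
      have h2 : (1 : ℝ) ≤ b 0 := by exact_mod_cast hlb 0
      have h3 : ∑ v : Fin 1 → Bool, (c v • toVec v) 0 ≤ ∑ v : Fin 1 → Bool, (1 : ℝ) := by
        apply Finset.sum_le_sum
        intro v _
        have := hc v
        simp only [toVec, Pi.smul_apply, smul_eq_mul]
        split_ifs <;> linarith
      rw [Finset.sum_apply] at h1
      simp at h1 h3
      have h4 : ∑ v : Fin 1 → Bool, c v * toVec v 0 ≤ 1 := by
        rw [← (Equiv.funUnique (Fin 1) Bool).symm.sum_comp]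
        have := hc ((Equiv.funUnique (Fin 1) Bool).symm true)
        simp [toVec, Equiv.funUnique] at this ⊢
        linarith
      linarith
  · set F := Finset.univ.filter (fun v => 0 < c v ∧ c v < 1) with hF
    set U := Finset.univ.filter (fun v => c v = 1) with hU
    have hsplit : ∀ i, (b i : ℝ) + (d : ℝ) ^ 2 = dg U i + ∑ v ∈ F, c v * toVec v i := by
      intro i
      have h1 := congrFun hp i
      simp only [Finset.sum_apply, Pi.smul_apply, smul_eq_mul] at h1
      rw [h1, ← dg_real, Finset.sum_apply, hF, hU, Finset.sum_filter, Finset.sum_filter,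
        ← Finset.sum_add_distrib]
      apply Finset.sum_congr rfl
      intro v _
      rcases eq_or_lt_of_le (hc v).2 with h | h
      · simp [h]
      · rcases eq_or_lt_of_le (hc v).1 with h' | h'
        · simp [← h']
        · simp [h, h', h.ne]
    have hf0 : ∀ i, 0 ≤ ∑ v ∈ F, c v * toVec v i := by
      intro i
      apply Finset.sum_nonneg
      intro v _
      have := (hc v).1
      simp only [toVec]
      split_ifs <;> linarith
    have hfd : ∀ i, ∑ v ∈ F, c v * toVec v i < d := by
      intro i
      rcases F.eq_empty_or_nonempty with h | h
      · rw [h]; simp; omega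
      · calc ∑ v ∈ F, c v * toVec v i < ∑ v ∈ F, (1 : ℝ) := by
              apply Finset.sum_lt_sum_of_nonempty h
              intro v hv
              have hv' : 0 < c v ∧ c v < 1 := by simpa [hF] using hv
              simp only [toVec]
              split_ifs <;> linarith
          _ ≤ d := by simpa using hcard
    have hup : ∀ i, dg U i - b i ≤ (d : ℤ) ^ 2 := by
      intro i
      have : (dg U i : ℝ) - b i ≤ (d : ℝ) ^ 2 := by linarith [hsplit i, hf0 i]
      exact_mod_cast this
    have hlo : ∀ i, (d : ℤ) ^ 2 - d + 1 ≤ dg U i - b i := by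
      intro i
      have : (d : ℝ) ^ 2 - d < (dg U i : ℝ) - b i := by linarith [hsplit i, hfd i]
      have : (d : ℤ) ^ 2 - d < dg U i - b i := by exact_mod_cast this
      omega
    have hm : (((d : ℤ) ^ 2 - d + 1).toNat : ℤ) = (d : ℤ) ^ 2 - d + 1 := by
      apply Int.toNat_of_nonneg
      nlinarith
    apply main_descent hd b hlb ((d : ℤ) ^ 2 - d + 1).toNat U
    · rw [hm]; exact hlo
    · rw [hm]
      calc ∑ i, (dg U i - b i - ((d : ℤ) ^ 2 - d + 1)) ≤ ∑ i : Fin d, ((d : ℤ) - 1) :=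
            Finset.sum_le_sum fun i _ => by linarith [hup i]
        _ ≤ (d : ℤ) ^ 2 - d + 1 := by
            simp
            nlinarith
end

section
/- For every d ≥ C(8,2) + C(8,4) = 98, the degree-sequence polytope Z^d contains an integer point that is not a degree sequence; i.e. there exists b ∈ Z^d ∩ ℤ^d with b ∉ S. -/
open Finset

/-- Existence of a listing of the even subsets of a 5-element set by `Fin d`. -/
lemma exists_rows (d : ℕ) (hd : 98 ≤ d) :
    ∃ R : Fin d → Finset (Fin 5), (∀ k, Even (R k).card) ∧
      ∀ s : Finset (Fin 5), Even s.card → ∃ k, R k = s := by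
  have hc : Fintype.card {s : Finset (Fin 5) // Even s.card} ≤ Fintype.card (Fin d) := by
    refine (Fintype.card_subtype_le _).trans ?_
    simp
    omega
  obtain ⟨f⟩ := Function.Embedding.nonempty_of_card_le hc
  have : Nonempty {s : Finset (Fin 5) // Even s.card} := ⟨⟨∅, by simp⟩⟩
  refine ⟨fun k => (Function.invFun f k).1, fun k => (Function.invFun f k).2, fun s hs => ?_⟩
  exact ⟨f ⟨s, hs⟩, by
    simp only [Function.leftInverse_invFun f.injective ⟨s, hs⟩]⟩

/-- Five reals whose even-size subset sums all lie in `{0,1}`: the first one is an integer. -/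
lemma integral_of_even_sums (x : Fin 5 → ℝ)
    (h : ∀ s : Finset (Fin 5), Even s.card → ∑ j ∈ s, x j = 0 ∨ ∑ j ∈ s, x j = 1) :
    ∃ z : ℤ, x 0 = z := by
  have h01 := h {0, 1} (by decide)
  have h02 := h {0, 2} (by decide)
  have h12 := h {1, 2} (by decide)
  have h03 := h {0, 3} (by decide)
  have h04 := h {0, 4} (by decide)
  have h13 := h {1, 3} (by decide)
  have h34 := h {3, 4} (by decide)
  have h23 := h {2, 3} (by decide)
  have h24 := h {2, 4} (by decide)
  have h14 := h {1, 4} (by decide)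
  have q0 := h {1, 2, 3, 4} (by decide)
  have q1 := h {0, 2, 3, 4} (by decide)
  have q2 := h {0, 1, 3, 4} (by decide)
  have q3 := h {0, 1, 2, 4} (by decide)
  have q4 := h {0, 1, 2, 3} (by decide)
  simp [Finset.sum_insert] at h01 h02 h12 h03 h04 h13 h34 h23 h24 h14 q0 q1 q2 q3 q4
  have key : x 0 = 0 ∨ x 0 = 1 := by
    rcases h01 with h01 | h01 <;> rcases h02 with h02 | h02 <;> rcases h12 with h12 | h12 <;>
    first
    | (left; linarith)
    | (right; linarith)
    | (exfalso
       rcases h03 with h03 | h03 <;> rcases h04 with h04 | h04 <;>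
       rcases h13 with h13 | h13 <;>
       rcases h34 with h34 | h34 <;> first
       | linarith
       | (rcases q0 with q0 | q0 <;> linarith)
       | (rcases q1 with q1 | q1 <;> linarith)
       | (rcases q2 with q2 | q2 <;> linarith)
       | (rcases q3 with q3 | q3 <;> linarith)
       | (rcases h23 with q0 | q0 <;> linarith)
       | (rcases h24 with q0 | q0 <;> linarith)
       | (rcases h14 with q0 | q0 <;> linarith)
       | (rcases q4 with q4 | q4 <;> linarith))
  rcases key with h | h
  · exact ⟨0, by simp [h]⟩
  · exact ⟨1, by simp [h]⟩

/-- The linear map sending `x` to its subset sums over the rows. -/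
noncomputable def rowMap {d : ℕ} (R : Fin d → Finset (Fin 5)) :
    (Fin 5 → ℝ) →ₗ[ℝ] (Fin d → ℝ) :=
  LinearMap.pi fun k => ∑ j ∈ R k, LinearMap.proj j

lemma rowMap_apply {d : ℕ} (R : Fin d → Finset (Fin 5)) (x : Fin 5 → ℝ) (k : Fin d) :
    rowMap R x k = ∑ j ∈ R k, x j := by
  simp [rowMap]

/-- A functional vanishing on 0/1 vectors exactly when they lie in the subspace. -/
lemma exists_functional {d : ℕ} (H : Submodule ℝ (Fin d → ℝ)) :
    ∃ g : (Fin d → ℝ) →ₗ[ℝ] ℝ, (∀ x ∈ H, g x = 0) ∧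
      ∀ v : Fin d → Bool, g (toVec v) = 0 → toVec v ∈ H := by
  obtain ⟨f, hf⟩ := Module.exists_dual_forall_apply_ne_zero (K := ℝ)
    (fun v : {v : Fin d → Bool // toVec v ∉ H} => H.mkQ (toVec v.1))
    (fun v hv => v.2 (by simpa using hv))
  refine ⟨f.comp H.mkQ, fun x hx => ?_, fun v hv => ?_⟩
  · have h0 : H.mkQ x = 0 := by simpa using hx
    rw [LinearMap.comp_apply, h0, map_zero]
  · by_contra hn
    exact hf ⟨v, hn⟩ hv

/-- For every `d ≥ C(8,2) + C(8,4) = 98` the degree-sequence polytope `Z^d` contains an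
integer point that is not a degree sequence. -/
theorem exists_nonrealizable_integer_point (d : ℕ)
    (hd : Nat.choose 8 2 + Nat.choose 8 4 ≤ d) :
    ∃ b : Fin d → ℤ,
      (fun i => (b i : ℝ)) ∈ dsPolytope d ∧ (fun i => (b i : ℝ)) ∉ degSeqs d := by
  have hd' : 98 ≤ d := hd
  obtain ⟨R, hR, hRs⟩ := exists_rows d hd'
  obtain ⟨g, hg, hgv⟩ := exists_functional (LinearMap.range (rowMap R))
  let e : Fin 5 → (Fin d → Bool) := fun i k => decide (i ∈ R k)
  have he : ∀ i, toVec (e i) = rowMap R (Pi.single i 1) := by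
    intro i
    funext k
    simp [toVec, e, rowMap_apply]
  have hge : ∀ i, g (toVec (e i)) = 0 := fun i => hg _ ⟨_, (he i).symm⟩
  have heinj : Function.Injective e := by
    intro i j hij
    by_contra hne
    obtain ⟨m, hmi, hmj⟩ : ∃ m, m ≠ i ∧ m ≠ j := by
      have : ∀ i j : Fin 5, ∃ m, m ≠ i ∧ m ≠ j := by decide
      exact this i j
    obtain ⟨k, hk⟩ := hRs {i, m} (by rw [Finset.card_pair hmi.symm]; decide)
    have := congrFun hij k
    simp [e, hk] at this
    rcases this with h | h
    · exact hne h.symm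
    · exact hmj h.symm
  have hsum : ∑ i, (1 / 2 : ℝ) • toVec (e i) = rowMap R (fun _ => 1 / 2) := by
    have h1 : (fun _ => 1 / 2 : Fin 5 → ℝ) = ∑ i, (1 / 2 : ℝ) • Pi.single i (1 : ℝ) := by
      funext k
      simp [Finset.sum_apply, Pi.single_apply]
    rw [h1, map_sum]
    simp only [map_smul, he]
  set P : Finset (Fin d → Bool) := univ.filter fun v => 0 < g (toVec v) with hP
  refine ⟨fun k => (∑ v ∈ P, if v k then 1 else 0) + ((R k).card / 2 : ℕ), ?_, ?_⟩
  all_goals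
    have hb : (fun k => (((∑ v ∈ P, if v k then 1 else 0) + ((R k).card / 2 : ℕ) : ℤ) : ℝ))
        = ∑ v ∈ P, toVec v + rowMap R (fun _ => 1 / 2) := by
      funext k
      obtain ⟨t, ht⟩ := hR k
      have ht2 : (R k).card / 2 = t := by omega
      rw [ht2]
      simp [rowMap_apply, Finset.sum_apply, toVec, ht]
      try ring
    rw [hb]
  · refine ⟨fun v => (if v ∈ P then 1 else 0) + (if v ∈ univ.image e then 1 / 2 else 0), ?_, ?_⟩
    · intro v
      have hdis : v ∈ univ.image e → v ∉ P := by
        intro h1 h2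
        obtain ⟨i, -, rfl⟩ := Finset.mem_image.1 h1
        simp [hP, hge] at h2
      by_cases h1 : v ∈ univ.image e
      · have h2 := hdis h1
        simp only [h1, h2, if_true, if_false]
        norm_num
      · by_cases h2 : v ∈ P <;> simp only [h1, h2, if_true, if_false] <;> norm_num
    · rw [← hsum]
      simp only [add_smul, Finset.sum_add_distrib, ite_smul, zero_smul, one_smul,
        Finset.sum_ite_mem, Finset.univ_inter]
      rw [Finset.sum_image (fun i _ j _ h => heinj h)]
  · rintro ⟨U, hU⟩
    have hgU : ∑ v ∈ P, g (toVec v) = ∑ v ∈ U, g (toVec v) := by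
      have := congrArg g hU
      rw [map_add, map_sum, map_sum, hg _ ⟨_, rfl⟩, add_zero] at this
      exact this
    -- compare termwise over all vectors
    have hterm : ∀ v, (if v ∈ P then g (toVec v) else 0) = if v ∈ U then g (toVec v) else 0 := by
      have hle : ∀ v ∈ (univ : Finset (Fin d → Bool)),
          (if v ∈ U then g (toVec v) else 0) ≤ (if v ∈ P then g (toVec v) else 0) := by
        intro v _
        by_cases h1 : v ∈ P <;> by_cases h2 : v ∈ U <;> simp only [h1, h2, if_true, if_false] <;>
          simp [hP] at h1 <;> linarith
      have := (Finset.sum_eq_sum_iff_of_le hle).1 (by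
        simp only [Finset.sum_ite_mem, Finset.univ_inter]; exact hgU.symm)
      exact fun v => (this v (mem_univ v)).symm
    have hPU : P ⊆ U := by
      intro v hv
      by_contra hn
      have := hterm v
      simp only [hv, hn, if_true, if_false] at this
      simp [hP] at hv
      linarith
    have hrest : ∑ v ∈ U \ P, toVec v = rowMap R (fun _ => 1 / 2) := by
      have := Finset.sum_sdiff (f := fun v => toVec v) hPU
      rw [← hU, add_comm] at this
      exact add_left_cancel this
    have hx : ∀ v ∈ U \ P, ∃ x : Fin 5 → ℝ, rowMap R x = toVec v := by
      intro v hv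
      obtain ⟨hvU, hvP⟩ := Finset.mem_sdiff.1 hv
      have := hterm v
      simp only [hvU, hvP, if_true, if_false] at this
      exact hgv v this.symm
    choose! x hx using hx
    have hint : ∀ v ∈ U \ P, ∃ z : ℤ, x v 0 = z := by
      intro v hv
      apply integral_of_even_sums
      intro s hs
      obtain ⟨k, rfl⟩ := hRs s hs
      rw [← rowMap_apply, hx v hv]
      unfold toVec
      by_cases h : v k = true <;> simp [h]
    choose! z hz using hint
    have hA : rowMap R (∑ v ∈ U \ P, x v) = rowMap R (fun _ => 1 / 2) := by
      rw [← hrest, map_sum]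
      exact Finset.sum_congr rfl hx
    set y := ∑ v ∈ U \ P, x v with hy
    have hev : ∀ s : Finset (Fin 5), Even s.card → ∑ j ∈ s, y j = ∑ j ∈ s, (1 / 2 : ℝ) := by
      intro s hs
      obtain ⟨k, rfl⟩ := hRs s hs
      have := congrFun hA k
      rwa [rowMap_apply, rowMap_apply] at this
    have h01 := hev {0, 1} (by decide)
    have h02 := hev {0, 2} (by decide)
    have h12 := hev {1, 2} (by decide)
    simp [Finset.sum_insert] at h01 h02 h12
    have hy0 : y 0 = ((∑ v ∈ U \ P, z v : ℤ) : ℝ) := by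
      rw [hy, Finset.sum_apply, Int.cast_sum]
      exact Finset.sum_congr rfl hz
    have h2 : ((2 * (∑ v ∈ U \ P, z v) : ℤ) : ℝ) = (1 : ℤ) := by
      push_cast at hy0 ⊢
      linarith
    have h3 : 2 * (∑ v ∈ U \ P, z v) = 1 := by exact_mod_cast h2
    omega
end

section
/- Let a ∈ ℤ_{≥0}^d and β ∈ ℤ_{≥0}, and let N := |{x ∈ {0,1}^d : ⟨a, x⟩ < β}| be the number of knapsack solutions. Define w₁ := (−a, β) ∈ ℝ^{d+1} and w₂ := (−a, β − 1/2) ∈ ℝ^{d+1}, and let OPT₁ := max{⟨w₁, x⟩ : x ∈ Z^{d+1}} and OPT₂ := max{⟨w₂, x⟩ : x ∈ Z^{d+1}} be the optimum values of the corresponding linear optimization problems over the degree-sequence polytope Z^{d+1}. Then OPT₁ = OPT₂ + N/2. -/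
open Finset

lemma opt_isGreatest (n : ℕ) (w : Fin n → ℝ) :
    IsGreatest ((fun x => ∑ j, w j * x j) '' dsPolytope n)
      (∑ v : Fin n → Bool, max 0 (∑ j, w j * toVec v j)) := by
  have key : ∀ c : (Fin n → Bool) → ℝ,
      ∑ j, w j * (∑ v : Fin n → Bool, c v • toVec v) j
        = ∑ v : Fin n → Bool, c v * ∑ j, w j * toVec v j := by
    intro c
    simp only [Finset.sum_apply, Pi.smul_apply, smul_eq_mul, Finset.mul_sum]
    rw [Finset.sum_comm]
    refine Finset.sum_congr rfl fun v _ => Finset.sum_congr rfl fun j _ => by ring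
  constructor
  · classical
    refine ⟨∑ v : Fin n → Bool, (if 0 ≤ ∑ j, w j * toVec v j then (1 : ℝ) else 0) • toVec v,
      ⟨_, fun v => ?_, rfl⟩, ?_⟩
    · split_ifs <;> norm_num
    · refine (key _).trans (Finset.sum_congr rfl fun v _ => ?_)
      split_ifs with h
      · rw [max_eq_right h, one_mul]
      · rw [max_eq_left (not_le.mp h).le, zero_mul]
  · rintro _ ⟨_, ⟨c, hc, rfl⟩, rfl⟩
    refine (key c).le.trans (Finset.sum_le_sum fun v _ => ?_)
    obtain ⟨h0, h1⟩ := hc v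
    rcases le_total 0 (∑ j, w j * toVec v j) with h | h
    · rw [max_eq_right h]; nlinarith
    · rw [max_eq_left h]; nlinarith

lemma opt_split (d : ℕ) (a : Fin d → ℤ) (ha : ∀ i, 0 ≤ a i) (b : ℝ) :
    ∑ v : Fin (d + 1) → Bool, max 0 (∑ j,
      (Fin.snoc (fun i => -(a i : ℝ)) b : Fin (d + 1) → ℝ) j * toVec v j)
    = ∑ x : Fin d → Bool,
        max 0 (b - ((∑ i, a i * (if x i then 1 else 0) : ℤ) : ℝ)) := by
  rw [← (Fin.snocEquiv (fun _ : Fin (d + 1) => Bool)).sum_comp, Fintype.sum_prod_type]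
  have e : ∀ (t : Bool) (x : Fin d → Bool), ∑ j,
      (Fin.snoc (fun i => -(a i : ℝ)) b : Fin (d + 1) → ℝ) j *
        toVec (Fin.snocEquiv (fun _ : Fin (d + 1) => Bool) (t, x)) j
      = b * (if t then 1 else 0) - ((∑ i, a i * (if x i then 1 else 0) : ℤ) : ℝ) := by
    intro t x
    rw [Fin.sum_univ_castSucc]
    simp [toVec, Fin.snocEquiv]
    rw [add_comm, sub_eq_add_neg, ← Finset.sum_neg_distrib]
    congr 1
    refine Finset.sum_congr rfl fun i _ => ?_
    split_ifs <;> simp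
  simp only [e, Fintype.sum_bool]
  rw [add_eq_left.mpr]
  · simp
  · refine Finset.sum_eq_zero fun x _ => max_eq_left ?_
    have : (0 : ℤ) ≤ ∑ i, a i * (if x i then 1 else 0) :=
      Finset.sum_nonneg fun i _ => by split_ifs <;> simp [ha i]
    have : (0 : ℝ) ≤ ((∑ i, a i * (if x i then 1 else 0) : ℤ) : ℝ) := by exact_mod_cast this
    simpa only [Bool.false_eq_true, if_false, mul_zero, zero_sub, neg_nonpos] using this

/-- Counting knapsack solutions via linear optimization over the degree-sequence polytope:
with `w₁ = (-a, β)` and `w₂ = (-a, β - 1/2)` in `ℝ^(d+1)`, the optimum values `OPT₁`,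
`OPT₂` of the corresponding linear optimization problems over `Z^(d+1)` exist and satisfy
`OPT₁ = OPT₂ + N/2`, where `N = |{x ∈ {0,1}^d : ⟨a, x⟩ < β}|`. -/
theorem opt_difference_counts_knapsack (d : ℕ) (a : Fin d → ℤ) (ha : ∀ i, 0 ≤ a i)
    (β : ℤ) (hβ : 0 ≤ β) :
    ∃ OPT₁ OPT₂ : ℝ,
      IsGreatest
        ((fun x => ∑ j, (Fin.snoc (fun i => -(a i : ℝ)) (β : ℝ) : Fin (d + 1) → ℝ) j * x j)
          '' dsPolytope (d + 1)) OPT₁ ∧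
      IsGreatest
        ((fun x => ∑ j,
            (Fin.snoc (fun i => -(a i : ℝ)) ((β : ℝ) - 1 / 2) : Fin (d + 1) → ℝ) j * x j)
          '' dsPolytope (d + 1)) OPT₂ ∧
      OPT₁ = OPT₂ +
        ((Finset.univ.filter
            (fun x : Fin d → Bool => ∑ i, a i * (if x i then 1 else 0) < β)).card : ℝ) / 2 := by
  refine ⟨_, _, opt_isGreatest _ _, opt_isGreatest _ _, ?_⟩
  rw [opt_split d a ha, opt_split d a ha, Finset.card_filter, Nat.cast_sum, Finset.sum_div,
    ← Finset.sum_add_distrib]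
  refine Finset.sum_congr rfl fun x _ => ?_
  generalize (∑ i, a i * (if x i then 1 else 0) : ℤ) = s
  split_ifs with h
  · have h' : (s : ℝ) + 1 ≤ β := by exact_mod_cast h
    rw [max_eq_right (by linarith), max_eq_right (by linarith)]
    push_cast; ring
  · have h' : (β : ℝ) ≤ s := by exact_mod_cast not_lt.mp h
    rw [max_eq_left (by linarith), max_eq_left (by linarith)]
    simp
end
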